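/- Let X and Y be separable metric spaces, k_x and k_y bounded continuous symmetric positive semidefinite kernels on X and Y, and k_xy the product kernel k_xy((x,y),(x',y')) := k_x(x,x')·k_y(y,y'). Let P be a probability measure on X, Q a probability measure on Y, and (P̂_n), (Q̂_n) sequences of finite signed Borel measures on X and Y. If E_{k_x}(P̂_n − P) → 0 and E_{k_y}(Q̂_n − Q) → 0 as n → ∞, then E_{k_xy}(P̂_n ⊗ Q̂_n − P ⊗ Q) → 0. -/

import Mathlib

open MeasureTheory Filter Topology

/-- Integral of a real-valued function against a finite signed measure,
defined via the Jordan decomposition. -/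
noncomputable def sintegral {X : Type*} [MeasurableSpace X]
    (ν : SignedMeasure X) (g : X → ℝ) : ℝ :=
  (∫ x, g x ∂ν.toJordanDecomposition.posPart) -
    (∫ x, g x ∂ν.toJordanDecomposition.negPart)

/-- The kernel energy `E_k(ν) = ∬ k(x,x') dν(x) dν(x')` of a finite signed measure. -/
noncomputable def energy {X : Type*} [MeasurableSpace X]
    (k : X × X → ℝ) (ν : SignedMeasure X) : ℝ :=
  sintegral ν fun x => sintegral ν fun y => k (x, y)

/-- The product `μ ⊗ ν` of two finite signed measures, defined via the Jordan
decompositions: `(μ⁺⊗ν⁺ + μ⁻⊗ν⁻) − (μ⁺⊗ν⁻ + μ⁻⊗ν⁺)`. -/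
noncomputable def sprod {X Y : Type*} [MeasurableSpace X] [MeasurableSpace Y]
    (μ : SignedMeasure X) (ν : SignedMeasure Y) : SignedMeasure (X × Y) :=
  ((μ.toJordanDecomposition.posPart.prod ν.toJordanDecomposition.posPart).toSignedMeasure +
      (μ.toJordanDecomposition.negPart.prod ν.toJordanDecomposition.negPart).toSignedMeasure) -
    ((μ.toJordanDecomposition.posPart.prod ν.toJordanDecomposition.negPart).toSignedMeasure +
      (μ.toJordanDecomposition.negPart.prod ν.toJordanDecomposition.posPart).toSignedMeasure)

universe uu

lemma exists_feature {X : Type uu} (k : X × X → ℝ)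
    (hsymm : ∀ a b, k (a, b) = k (b, a))
    (hpsd : ∀ (m : ℕ) (x : Fin m → X) (c : Fin m → ℝ),
      0 ≤ ∑ i, ∑ j, c i * c j * k (x i, x j)) :
    ∃ (H : Type uu) (_ : NormedAddCommGroup H) (_ : InnerProductSpace ℝ H) (_ : CompleteSpace H)
      (Φ : X → H), ∀ x y, inner ℝ (Φ x) (Φ y) = k (x, y) := by
  let K : Matrix X X (ℝ →L[ℝ] ℝ) := .of fun x y => k (x, y) • ContinuousLinearMap.id ℝ ℝ
  have hK : K.PosSemidef := by
    have ht := (RKHS.posSemidef_tfae (K := K)).out 0 2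
    refine ht.mpr ⟨?_, ?_⟩
    · ext x y
      have h1 : star (ContinuousLinearMap.id ℝ ℝ) = ContinuousLinearMap.id ℝ ℝ :=
        star_one (ℝ →L[ℝ] ℝ)
      simp [K, Matrix.conjTranspose_apply, hsymm x y, star_smul, h1]
    · intro vv
      have h := hpsd vv.support.card (fun i => (vv.support.equivFin.symm i : X))
        (fun i => vv (vv.support.equivFin.symm i))
      have e : (vv.sum fun x w ↦ vv.sum fun x' w' ↦ inner ℝ (K x' x w) w') =
          ∑ i : Fin vv.support.card, ∑ j : Fin vv.support.card,
            vv (vv.support.equivFin.symm i) * vv (vv.support.equivFin.symm j) *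
            k ((vv.support.equivFin.symm i : X), (vv.support.equivFin.symm j : X)) := by
        rw [Equiv.sum_comp vv.support.equivFin.symm
          (fun a : vv.support => ∑ j : Fin vv.support.card,
            vv a * vv (vv.support.equivFin.symm j) * k ((a : X), (vv.support.equivFin.symm j : X)))]
        simp only [Finsupp.sum]
        rw [← Finset.sum_coe_sort vv.support]
        refine Finset.sum_congr rfl fun a _ => ?_
        rw [Equiv.sum_comp vv.support.equivFin.symm
          (fun b : vv.support => vv a * vv b * k ((a : X), (b : X)))]
        rw [← Finset.sum_coe_sort vv.support]
        refine Finset.sum_congr rfl fun b _ => ?_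
        simp [K, hsymm (b : X) a]
        ring
      rw [e]
      simpa using h
  have : Fact K.PosSemidef := ⟨hK⟩
  refine ⟨RKHS.OfKernel K, inferInstance, inferInstance, inferInstance,
    fun x => RKHS.kerFun (RKHS.OfKernel K) x (1 : ℝ), fun x y => ?_⟩
  rw [← RKHS.kernel_inner, RKHS.OfKernel.kernel_ofKernel]
  simp [K, hsymm y x]

/-- Vector-valued version of `sintegral`. -/
noncomputable def vint {X : Type*} [MeasurableSpace X] {E : Type*} [NormedAddCommGroup E]
    [NormedSpace ℝ E] (ν : SignedMeasure X) (g : X → E) : E :=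
  (∫ x, g x ∂ν.toJordanDecomposition.posPart) -
    (∫ x, g x ∂ν.toJordanDecomposition.negPart)

lemma sintegral_eq_vint {X : Type*} [MeasurableSpace X] (ν : SignedMeasure X) (g : X → ℝ) :
    sintegral ν g = vint ν g := rfl

lemma jordan_eq {X : Type*} [MeasurableSpace X] (ν : SignedMeasure X) :
    ν.toJordanDecomposition.posPart.toSignedMeasure -
      ν.toJordanDecomposition.negPart.toSignedMeasure = ν :=
  ν.toSignedMeasure_toJordanDecomposition

lemma vint_repr {X : Type*} [MeasurableSpace X] {E : Type*} [NormedAddCommGroup E]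
    [NormedSpace ℝ E] (ν : SignedMeasure X) (g : X → E)
    (hg : ∀ μ : Measure X, IsFiniteMeasure μ → Integrable g μ)
    (μ₁ μ₂ : Measure X) [IsFiniteMeasure μ₁] [IsFiniteMeasure μ₂]
    (h : ν = μ₁.toSignedMeasure - μ₂.toSignedMeasure) :
    vint ν g = (∫ x, g x ∂μ₁) - ∫ x, g x ∂μ₂ := by
  have h1 : ν.toJordanDecomposition.posPart + μ₂ = μ₁ + ν.toJordanDecomposition.negPart := by
    rw [← Measure.toSignedMeasure_eq_toSignedMeasure_iff, Measure.toSignedMeasure_add,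
      Measure.toSignedMeasure_add, ← sub_eq_sub_iff_add_eq_add, jordan_eq, h]
  have h2 : (∫ x, g x ∂(ν.toJordanDecomposition.posPart + μ₂)) =
      ∫ x, g x ∂(μ₁ + ν.toJordanDecomposition.negPart) := by rw [h1]
  rw [integral_add_measure (hg _ inferInstance) (hg _ inferInstance),
    integral_add_measure (hg _ inferInstance) (hg _ inferInstance)] at h2
  rw [vint, sub_eq_sub_iff_add_eq_add, h2]

lemma vint_sub {X : Type*} [MeasurableSpace X] {E : Type*} [NormedAddCommGroup E]
    [NormedSpace ℝ E] (α β : SignedMeasure X) (g : X → E)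
    (hg : ∀ μ : Measure X, IsFiniteMeasure μ → Integrable g μ) :
    vint (α - β) g = vint α g - vint β g := by
  rw [vint_repr (α - β) g hg
    (α.toJordanDecomposition.posPart + β.toJordanDecomposition.negPart)
    (α.toJordanDecomposition.negPart + β.toJordanDecomposition.posPart)]
  · rw [integral_add_measure (hg _ inferInstance) (hg _ inferInstance),
      integral_add_measure (hg _ inferInstance) (hg _ inferInstance), vint, vint]
    abel
  · rw [Measure.toSignedMeasure_add, Measure.toSignedMeasure_add]
    conv_lhs => rw [← jordan_eq α, ← jordan_eq β]
    abel

lemma vint_inner {X : Type*} [MeasurableSpace X] {E : Type*} [NormedAddCommGroup E]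
    [InnerProductSpace ℝ E] [CompleteSpace E] (α : SignedMeasure X) (g : X → E)
    (hg : ∀ μ : Measure X, IsFiniteMeasure μ → Integrable g μ) (u : E) :
    sintegral α (fun x => inner ℝ u (g x)) = inner ℝ u (vint α g) := by
  rw [sintegral, integral_inner (hg _ inferInstance), integral_inner (hg _ inferInstance), vint,
    inner_sub_right]

lemma sintegral_sprod {X Y : Type*} [MeasurableSpace X] [MeasurableSpace Y]
    (α : SignedMeasure X) (β : SignedMeasure Y) (f : X → ℝ) (h : Y → ℝ)
    (hg : ∀ μ : Measure (X × Y), IsFiniteMeasure μ → Integrable (fun p => f p.1 * h p.2) μ) :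
    sintegral (sprod α β) (fun p => f p.1 * h p.2) = sintegral α f * sintegral β h := by
  rw [sintegral_eq_vint, vint_repr (sprod α β) _ hg
    (α.toJordanDecomposition.posPart.prod β.toJordanDecomposition.posPart +
      α.toJordanDecomposition.negPart.prod β.toJordanDecomposition.negPart)
    (α.toJordanDecomposition.posPart.prod β.toJordanDecomposition.negPart +
      α.toJordanDecomposition.negPart.prod β.toJordanDecomposition.posPart)]
  · rw [integral_add_measure (hg _ inferInstance) (hg _ inferInstance),
      integral_add_measure (hg _ inferInstance) (hg _ inferInstance)]
    simp only [integral_prod_mul, sintegral]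
    ring
  · rw [Measure.toSignedMeasure_add, Measure.toSignedMeasure_add, sprod]

lemma feature_cont {X : Type*} [TopologicalSpace X] (k : X × X → ℝ) (hk : Continuous k)
    {H : Type*} [NormedAddCommGroup H] [InnerProductSpace ℝ H] (Φ : X → H)
    (h : ∀ x y, inner ℝ (Φ x) (Φ y) = k (x, y)) : Continuous Φ := by
  rw [continuous_iff_continuousAt]
  intro x
  rw [ContinuousAt, tendsto_iff_norm_sub_tendsto_zero]
  have e : ∀ y, ‖Φ y - Φ x‖ = √(k (y, y) - 2 * k (y, x) + k (x, x)) := by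
    intro y
    rw [← h, ← h, ← h, ← Real.sqrt_sq (norm_nonneg (Φ y - Φ x)), norm_sub_sq_real,
      real_inner_self_eq_norm_sq, real_inner_self_eq_norm_sq]
  simp only [e]
  have hc : Continuous fun y => √(k (y, y) - 2 * k (y, x) + k (x, x)) := by fun_prop
  have := hc.tendsto x
  have e0 : k (x, x) - 2 * k (x, x) + k (x, x) = 0 := by ring
  simpa [e0] using this

lemma feature_bdd {X : Type*} (k : X × X → ℝ) (hk : ∃ M, ∀ p, |k p| ≤ M)
    {H : Type*} [NormedAddCommGroup H] [InnerProductSpace ℝ H] (Φ : X → H)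
    (h : ∀ x y, inner ℝ (Φ x) (Φ y) = k (x, y)) : ∃ C, ∀ x, ‖Φ x‖ ≤ C := by
  obtain ⟨M, hM⟩ := hk
  refine ⟨√M, fun x => Real.le_sqrt_of_sq_le ?_⟩
  rw [← real_inner_self_eq_norm_sq, h]
  exact (le_abs_self _).trans (hM _)

lemma integrable_of_cont_bdd {X : Type*} [TopologicalSpace X] [TopologicalSpace.PseudoMetrizableSpace X]
    [SecondCountableTopology X]
    [MeasurableSpace X] [OpensMeasurableSpace X] {E : Type*} [NormedAddCommGroup E]
    (g : X → E) (hc : Continuous g) (hb : ∃ C, ∀ x, ‖g x‖ ≤ C)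
    (μ : Measure X) (_ : IsFiniteMeasure μ) : Integrable g μ := by
  obtain ⟨C, hC⟩ := hb
  exact Integrable.of_bound hc.aestronglyMeasurable C (ae_of_all _ hC)

lemma tendsto_of_sq {E : Type*} [NormedAddCommGroup E] (a : ℕ → E) (b : E)
    (h : Tendsto (fun n => ‖a n - b‖ ^ 2) atTop (𝓝 0)) : Tendsto a atTop (𝓝 b) := by
  rw [tendsto_iff_norm_sub_tendsto_zero]
  simpa [Real.sqrt_sq] using h.sqrt

lemma sintegral_fsub {X : Type*} [MeasurableSpace X] (α : SignedMeasure X) (f g : X → ℝ)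
    (hf : ∀ μ : Measure X, IsFiniteMeasure μ → Integrable f μ)
    (hg : ∀ μ : Measure X, IsFiniteMeasure μ → Integrable g μ) :
    sintegral α (fun x => f x - g x) = sintegral α f - sintegral α g := by
  simp only [sintegral]
  rw [integral_sub (hf _ inferInstance) (hg _ inferInstance),
    integral_sub (hf _ inferInstance) (hg _ inferInstance)]
  ring

/-- Corollary 4 of the paper: consistency of the marginal mean-embedding estimators
implies consistency of their tensor product as an estimator of the joint embedding,
stated in terms of kernel energies of the errors. -/
theorem consistency_transfer_to_product_embedding
    {X Y : Type*}
    [MetricSpace X] [TopologicalSpace.SeparableSpace X] [MeasurableSpace X] [BorelSpace X]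
    [MetricSpace Y] [TopologicalSpace.SeparableSpace Y] [MeasurableSpace Y] [BorelSpace Y]
    (kx : X × X → ℝ) (hkx_bdd : ∃ M, ∀ p, |kx p| ≤ M) (hkx_cont : Continuous kx)
    (hkx_symm : ∀ a b, kx (a, b) = kx (b, a))
    (hkx_psd : ∀ (m : ℕ) (x : Fin m → X) (c : Fin m → ℝ),
      0 ≤ ∑ i, ∑ j, c i * c j * kx (x i, x j))
    (ky : Y × Y → ℝ) (hky_bdd : ∃ M, ∀ p, |ky p| ≤ M) (hky_cont : Continuous ky)
    (hky_symm : ∀ a b, ky (a, b) = ky (b, a))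
    (hky_psd : ∀ (m : ℕ) (y : Fin m → Y) (c : Fin m → ℝ),
      0 ≤ ∑ i, ∑ j, c i * c j * ky (y i, y j))
    (P : Measure X) [IsProbabilityMeasure P] (Q : Measure Y) [IsProbabilityMeasure Q]
    (Phat : ℕ → SignedMeasure X) (Qhat : ℕ → SignedMeasure Y)
    (hP : Tendsto (fun n => energy kx (Phat n - P.toSignedMeasure)) atTop (𝓝 0))
    (hQ : Tendsto (fun n => energy ky (Qhat n - Q.toSignedMeasure)) atTop (𝓝 0)) :
    Tendsto (fun n => energy
        (fun p : (X × Y) × (X × Y) => kx (p.1.1, p.2.1) * ky (p.1.2, p.2.2))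
        (sprod (Phat n) (Qhat n) - sprod P.toSignedMeasure Q.toSignedMeasure))
      atTop (𝓝 0) := by
  obtain ⟨H, _, _, _, Φ, hΦ⟩ := exists_feature kx hkx_symm hkx_psd
  obtain ⟨G, _, _, _, Ψ, hΨ⟩ := exists_feature ky hky_symm hky_psd
  have : SecondCountableTopology X := UniformSpace.secondCountable_of_separable X
  have : SecondCountableTopology Y := UniformSpace.secondCountable_of_separable Y
  have cΦ := feature_cont kx hkx_cont Φ hΦ
  have cΨ := feature_cont ky hky_cont Ψ hΨ
  have bΦ := feature_bdd kx hkx_bdd Φ hΦ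
  have bΨ := feature_bdd ky hky_bdd Ψ hΨ
  have iΦ := integrable_of_cont_bdd Φ cΦ bΦ
  have iΨ := integrable_of_cont_bdd Ψ cΨ bΨ
  have iP : ∀ (u : H) (v : G) (μ : Measure (X × Y)), IsFiniteMeasure μ →
      Integrable (fun p : X × Y => inner ℝ u (Φ p.1) * inner ℝ v (Ψ p.2)) μ := by
    intro u v
    refine integrable_of_cont_bdd _ (by fun_prop) ?_
    obtain ⟨C, hC⟩ := bΦ
    obtain ⟨D, hD⟩ := bΨ
    refine ⟨(‖u‖ * C) * (‖v‖ * D), fun p => ?_⟩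
    rw [norm_mul]
    have h1 : ‖inner ℝ u (Φ p.1)‖ ≤ ‖u‖ * C :=
      (norm_inner_le_norm _ _).trans (mul_le_mul_of_nonneg_left (hC _) (norm_nonneg _))
    have h2 : ‖inner ℝ v (Ψ p.2)‖ ≤ ‖v‖ * D :=
      (norm_inner_le_norm _ _).trans (mul_le_mul_of_nonneg_left (hD _) (norm_nonneg _))
    exact mul_le_mul h1 h2 (norm_nonneg _) ((norm_nonneg _).trans h1)
  have eX : ∀ α : SignedMeasure X, energy kx α = ‖vint α Φ‖ ^ 2 := by
    intro α
    simp only [energy, ← hΦ, vint_inner α Φ iΦ]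
    simp only [real_inner_comm (vint α Φ)]
    rw [← real_inner_self_eq_norm_sq, vint_inner α Φ iΦ]
  have eY : ∀ α : SignedMeasure Y, energy ky α = ‖vint α Ψ‖ ^ 2 := by
    intro α
    simp only [energy, ← hΨ, vint_inner α Ψ iΨ]
    simp only [real_inner_comm (vint α Ψ)]
    rw [← real_inner_self_eq_norm_sq, vint_inner α Ψ iΨ]
  have tP : Tendsto (fun n => vint (Phat n) Φ) atTop (𝓝 (vint P.toSignedMeasure Φ)) := by
    refine tendsto_of_sq _ _ ?_
    simpa only [eX, vint_sub _ _ Φ iΦ] using hP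
  have tQ : Tendsto (fun n => vint (Qhat n) Ψ) atTop (𝓝 (vint Q.toSignedMeasure Ψ)) := by
    refine tendsto_of_sq _ _ ?_
    simpa only [eY, vint_sub _ _ Ψ iΨ] using hQ
  have sP : ∀ (α : SignedMeasure X) (β : SignedMeasure Y) (u : H) (v : G),
      sintegral (sprod α β) (fun p => inner ℝ u (Φ p.1) * inner ℝ v (Ψ p.2)) =
        inner ℝ u (vint α Φ) * inner ℝ v (vint β Ψ) := by
    intro α β u v
    rw [sintegral_sprod α β (fun x => inner ℝ u (Φ x)) (fun y => inner ℝ v (Ψ y)) (iP u v),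
      vint_inner α Φ iΦ, vint_inner β Ψ iΨ]
  have sD : ∀ (a c : SignedMeasure X) (b d : SignedMeasure Y) (u : H) (v : G),
      sintegral (sprod a b - sprod c d) (fun p => inner ℝ u (Φ p.1) * inner ℝ v (Ψ p.2)) =
        inner ℝ u (vint a Φ) * inner ℝ v (vint b Ψ) -
          inner ℝ u (vint c Φ) * inner ℝ v (vint d Ψ) := by
    intro a c b d u v
    rw [sintegral_eq_vint, vint_sub _ _ _ (iP u v), ← sintegral_eq_vint, ← sintegral_eq_vint,
      sP, sP]
  have eXY : ∀ (a c : SignedMeasure X) (b d : SignedMeasure Y),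
      energy (fun p : (X × Y) × (X × Y) => kx (p.1.1, p.2.1) * ky (p.1.2, p.2.2))
        (sprod a b - sprod c d) =
      (inner ℝ (vint a Φ) (vint a Φ) * inner ℝ (vint b Ψ) (vint b Ψ) -
        inner ℝ (vint a Φ) (vint c Φ) * inner ℝ (vint b Ψ) (vint d Ψ)) -
      (inner ℝ (vint c Φ) (vint a Φ) * inner ℝ (vint d Ψ) (vint b Ψ) -
        inner ℝ (vint c Φ) (vint c Φ) * inner ℝ (vint d Ψ) (vint d Ψ)) := by
    intro a c b d
    simp only [energy, ← hΦ, ← hΨ, sD]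
    simp only [real_inner_comm (vint _ Φ) (Φ _), real_inner_comm (vint _ Ψ) (Ψ _)]
    rw [sintegral_fsub _ _ _ (iP _ _) (iP _ _), sD, sD]
  simp only [eXY]
  have cP := tendsto_const_nhds (x := vint P.toSignedMeasure Φ) (f := (atTop : Filter ℕ))
  have cQ := tendsto_const_nhds (x := vint Q.toSignedMeasure Ψ) (f := (atTop : Filter ℕ))
  have t := (((tP.inner (𝕜 := ℝ) tP).mul (tQ.inner (𝕜 := ℝ) tQ)).sub
    ((tP.inner (𝕜 := ℝ) cP).mul (tQ.inner (𝕜 := ℝ) cQ))).sub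
    (((cP.inner (𝕜 := ℝ) tP).mul (cQ.inner (𝕜 := ℝ) tQ)).sub
    ((cP.inner (𝕜 := ℝ) cP).mul (cQ.inner (𝕜 := ℝ) cQ)))
  rw [sub_self] at t
  exact t
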